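/- A probabilistic trace strategy σ (play-measure of weight 1) is victorious if and only if σ = ∑_{k∈ℕ} τ_k for a sequence of finitely founded play-measures τ_k with w(τ_k) = 2^{-k-1}. (In particular, every victorious strategy is a countable convex combination of finitely founded strategies.) -/

import Mathlib

open scoped ENNReal Classical

/-- Active-ending plays over signature `(K, ar)`: alternating sequences of
outputs `k : K` and inputs `i : ar k`. -/
inductive APlay (K : Type) (ar : K → Type) : Type
  | nil : APlay K ar
  | cons (k : K) (i : ar k) (s : APlay K ar) : APlay K ar

variable {K : Type} {ar : K → Type}

/-- Append an output-input pair at the end of an active-ending play. -/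
def APlay.snoc : APlay K ar → (k : K) → ar k → APlay K ar
  | .nil, k, i => .cons k i .nil
  | .cons l j s, k, i => .cons l j (s.snoc k i)

/-- The number of output-input cycles in an active-ending play. -/
def APlay.len : APlay K ar → ℕ
  | .nil => 0
  | .cons _ _ s => s.len + 1

/-- A play-measure: values in `[0,1]` on passive-ending plays (an active play
followed by an output), with `σ_act t = ∑_k σ_pass (t.k)` and
`σ_act (s.k.i) = σ_pass (s.k)`. -/
structure PlayMeasure (K : Type) (ar : K → Type) where
  pass : APlay K ar → K → ℝ≥0∞
  le_one : ∀ t, (∑' k, pass t k) ≤ 1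
  consistent : ∀ s k (i : ar k), pass s k = ∑' l, pass (s.snoc k i) l

/-- The value of a play-measure on an active-ending play. -/
noncomputable def PlayMeasure.act (σ : PlayMeasure K ar) (t : APlay K ar) : ℝ≥0∞ :=
  ∑' k, σ.pass t k

/-- The weight of a play-measure. -/
noncomputable def PlayMeasure.weight (σ : PlayMeasure K ar) : ℝ≥0∞ := σ.act .nil

/-- A partial counterstrategy, given by its set of active-ending plays. -/
structure Counterstrategy (K : Type) (ar : K → Type) where
  act : Set (APlay K ar)
  nil_mem : APlay.nil ∈ act
  prefix_closed : ∀ (s : APlay K ar) (k : K) (i : ar k), s.snoc k i ∈ act → s ∈ act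
  deterministic : ∀ (s : APlay K ar) (k : K) (i j : ar k),
      s.snoc k i ∈ act → s.snoc k j ∈ act → i = j

/-- The passive-ending play `s.k` is a `ρ`-failure: it is in `ρ_pass`
and has no prescribed input. -/
def Counterstrategy.Fails (ρ : Counterstrategy K ar) (s : APlay K ar) (k : K) : Prop :=
  s ∈ ρ.act ∧ ∀ i : ar k, s.snoc k i ∉ ρ.act

/-- `P^m_ρ(σ)`: the sum of `σ_act` over the length-`m` plays in `ρ_act`. -/
noncomputable def contProb (ρ : Counterstrategy K ar) (σ : PlayMeasure K ar) (m : ℕ) : ℝ≥0∞ :=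
  ∑' s : {s : APlay K ar // s ∈ ρ.act ∧ s.len = m}, σ.act s.1

/-- The sum of `σ_pass` over the `ρ`-failures of length `m`. -/
noncomputable def failProb (ρ : Counterstrategy K ar) (σ : PlayMeasure K ar) (m : ℕ) : ℝ≥0∞ :=
  ∑' p : {p : APlay K ar × K // ρ.Fails p.1 p.2 ∧ p.1.len = m}, σ.pass p.1.1 p.1.2

/-- A play-measure is victorious when against every partial counterstrategy,
the probability of play continuing forever is zero. -/
def Victorious (σ : PlayMeasure K ar) : Prop :=
  ∀ ρ : Counterstrategy K ar, (⨅ m, contProb ρ σ m) = 0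

/-- The length-`n` prefix of an infinite play. -/
def prefixPlay (f : ℕ → Σ k : K, ar k) : ℕ → APlay K ar
  | 0 => .nil
  | n + 1 => (prefixPlay f n).snoc (f n).1 (f n).2

/-- A play-measure is well-founded when no infinite play has all its
prefixes in the support. -/
def PlayMeasure.WellFoundedPM (σ : PlayMeasure K ar) : Prop :=
  ¬ ∃ f : ℕ → Σ k : K, ar k, ∀ n, 0 < σ.pass (prefixPlay f n) (f n).1

/-- A play-measure is finitely branching when each active-ending play has
finitely many possible next outputs in the support. -/
def PlayMeasure.FinBranch (σ : PlayMeasure K ar) : Prop :=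
  ∀ t : APlay K ar, {k : K | 0 < σ.pass t k}.Finite

/-- Finitely founded: well-founded and finitely branching. -/
def PlayMeasure.FinFounded (σ : PlayMeasure K ar) : Prop :=
  σ.WellFoundedPM ∧ σ.FinBranch

/-- `f` is uniformly below `g`: there is `d > 0` with `f s + d ≤ g s` on
every passive-ending play `s` in the support of `f`. -/
def UBelow (f g : APlay K ar → K → ℝ≥0∞) : Prop :=
  ∃ d : ℝ≥0∞, 0 < d ∧ ∀ s k, 0 < f s k → f s k + d ≤ g s k

namespace PMAux

/-- The residual of a set of plays after one cycle. -/
def shiftSet (A : Set (APlay K ar)) (k : K) (i : ar k) : Set (APlay K ar) :=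
  {s | APlay.cons k i s ∈ A}

/-- The residual play-measure after one cycle. -/
noncomputable def shift (σ : PlayMeasure K ar) (k : K) (i : ar k) : PlayMeasure K ar where
  pass s l := σ.pass (.cons k i s) l
  le_one t := σ.le_one _
  consistent s l j := σ.consistent (.cons k i s) l j

theorem shift_weight (σ : PlayMeasure K ar) (k : K) (i : ar k) :
    (shift σ k i).weight = σ.pass .nil k := (σ.consistent .nil k i).symm

theorem weight_le_one (σ : PlayMeasure K ar) : σ.weight ≤ 1 := σ.le_one _

theorem pass_nil_le (σ : PlayMeasure K ar) (k : K) : σ.pass .nil k ≤ σ.weight :=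
  ENNReal.le_tsum (f := fun k => σ.pass .nil k) k

theorem pass_le_weight (s : APlay K ar) : ∀ (σ : PlayMeasure K ar) (k : K),
    σ.pass s k ≤ σ.weight := by
  induction s with
  | nil => exact pass_nil_le
  | cons l j s ih =>
    intro σ k
    have h := ih (shift σ l j) k
    rw [shift_weight] at h
    exact h.trans (pass_nil_le σ l)

def playEquiv : Option (Σ k : K, ar k × APlay K ar) ≃ APlay K ar where
  toFun
    | none => .nil
    | some ⟨k, i, s⟩ => .cons k i s
  invFun
    | .nil => none
    | .cons k i s => some ⟨k, i, s⟩
  left_inv x := by rcases x with _ | ⟨k, i, s⟩ <;> rfl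
  right_inv x := by cases x <;> rfl

theorem tsum_option' {α : Type} (g : Option α → ℝ≥0∞) :
    ∑' x, g x = g none + ∑' a, g (some a) := by
  have e := (Equiv.optionEquivSumPUnit.{0} α).symm.tsum_eq g
  rw [← e, Summable.tsum_sum ENNReal.summable ENNReal.summable, add_comm]
  simp

theorem tsum_play (g : APlay K ar → ℝ≥0∞) :
    ∑' s, g s = g .nil + ∑' k, ∑' i : ar k, ∑' s, g (.cons k i s) := by
  rw [← playEquiv.tsum_eq g, tsum_option', ENNReal.tsum_sigma']
  congr 1
  refine tsum_congr fun k => ?_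
  rw [ENNReal.tsum_prod']
  rfl

/-- Continuation probability for an arbitrary set of plays. -/
noncomputable def contP (A : Set (APlay K ar)) (σ : PlayMeasure K ar) (m : ℕ) : ℝ≥0∞ :=
  ∑' s, if s ∈ A ∧ s.len = m then σ.act s else 0

theorem contProb_eq (ρ : Counterstrategy K ar) (σ : PlayMeasure K ar) (m : ℕ) :
    contProb ρ σ m = contP ρ.act σ m := by
  unfold contProb contP
  rw [show (∑' s : {s : APlay K ar // s ∈ ρ.act ∧ s.len = m}, σ.act s.1) = _ from
    tsum_subtype {s : APlay K ar | s ∈ ρ.act ∧ s.len = m} σ.act]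
  refine tsum_congr fun s => ?_
  simp [Set.indicator_apply]

theorem contP_zero (A : Set (APlay K ar)) (σ : PlayMeasure K ar) :
    contP A σ 0 = if APlay.nil ∈ A then σ.weight else 0 := by
  unfold contP
  rw [tsum_play]
  simp [APlay.len, PlayMeasure.weight]

theorem contP_succ (A : Set (APlay K ar)) (σ : PlayMeasure K ar) (m : ℕ) :
    contP A σ (m + 1) = ∑' k, ∑' i : ar k, contP (shiftSet A k i) (shift σ k i) m := by
  unfold contP
  rw [tsum_play]
  simp [APlay.len, shiftSet]
  rfl

/-- Prefix-closed and deterministic. -/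
structure Good (A : Set (APlay K ar)) : Prop where
  pc : ∀ (s : APlay K ar) (k : K) (i : ar k), s.snoc k i ∈ A → s ∈ A
  det : ∀ (s : APlay K ar) (k : K) (i j : ar k), s.snoc k i ∈ A → s.snoc k j ∈ A → i = j

theorem Good.shift {A : Set (APlay K ar)} (h : Good A) (k : K) (i : ar k) :
    Good (shiftSet A k i) :=
  ⟨fun s l j => h.pc (.cons k i s) l j, fun s l j j' => h.det (.cons k i s) l j j'⟩

theorem exists_snoc (s : APlay K ar) : ∀ (k : K) (i : ar k), ∃ t l j, APlay.cons k i s = APlay.snoc t l j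
    ∧ t.len = s.len := by
  induction s with
  | nil => exact fun k i => ⟨.nil, k, i, rfl, rfl⟩
  | cons k' i' s ih =>
    intro k i
    obtain ⟨t, l, j, h, h2⟩ := ih k' i'
    exact ⟨.cons k i t, l, j, by rw [h]; rfl, by simp [APlay.len, h2]⟩

theorem Good.nil_mem {A : Set (APlay K ar)} (h : Good A) :
    ∀ (n : ℕ) (s : APlay K ar), s.len = n → s ∈ A → APlay.nil ∈ A := by
  intro n
  induction n with
  | zero =>
    intro s hs hA
    cases s with
    | nil => exact hA
    | cons => simp [APlay.len] at hs
  | succ n ih =>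
    intro s hs hA
    cases s with
    | nil => exact hA
    | cons k i s =>
      obtain ⟨t, l, j, e, e2⟩ := exists_snoc s k i
      rw [e] at hA
      refine ih t ?_ (h.pc _ _ _ hA)
      simp [APlay.len] at hs
      omega

theorem contP_of_nil {A : Set (APlay K ar)} (h : Good A) (hn : APlay.nil ∉ A)
    (σ : PlayMeasure K ar) (m : ℕ) : contP A σ m = 0 := by
  unfold contP
  refine ENNReal.tsum_eq_zero.2 fun s => if_neg ?_
  rintro ⟨hs, -⟩
  exact hn (h.nil_mem _ s rfl hs)

theorem Good.unique {A : Set (APlay K ar)} (h : Good A) {k : K} {i j : ar k}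
    (hi : APlay.nil ∈ shiftSet A k i) (hj : APlay.nil ∈ shiftSet A k j) : i = j :=
  h.det .nil k i j hi hj

theorem contP_le_weight (m : ℕ) : ∀ {A : Set (APlay K ar)} (_ : Good A) (σ : PlayMeasure K ar),
    contP A σ m ≤ σ.weight := by
  induction m with
  | zero =>
    intro A _ σ
    rw [contP_zero]; split_ifs <;> simp
  | succ m ih =>
    intro A h σ
    rw [contP_succ]
    refine ENNReal.tsum_le_tsum fun k => ?_
    by_cases he : ∃ i : ar k, APlay.nil ∈ shiftSet A k i
    · obtain ⟨i, hi⟩ := he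
      rw [tsum_eq_single i]
      · exact (ih (h.shift k i) _).trans (shift_weight σ k i).le
      · intro j hj
        exact contP_of_nil (h.shift k j) (fun hj' => hj (h.unique hj' hi)) _ _
    · push Not at he
      rw [ENNReal.tsum_eq_zero.2 fun i => contP_of_nil (h.shift k i) (he i) _ _]
      exact zero_le

theorem contP_succ_le (m : ℕ) : ∀ {A : Set (APlay K ar)} (_ : Good A) (σ : PlayMeasure K ar),
    contP A σ (m + 1) ≤ contP A σ m := by
  induction m with
  | zero =>
    intro A h σ
    by_cases hn : APlay.nil ∈ A
    · rw [contP_zero, if_pos hn]; exact contP_le_weight _ h σ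
    · rw [contP_of_nil h hn]; exact zero_le
  | succ m ih =>
    intro A h σ
    rw [contP_succ, contP_succ A σ m]
    exact ENNReal.tsum_le_tsum fun k => ENNReal.tsum_le_tsum fun i => ih (h.shift k i) _

theorem contP_antitone {A : Set (APlay K ar)} (h : Good A) (σ : PlayMeasure K ar) :
    Antitone (contP A σ) := antitone_nat_of_succ_le fun m => contP_succ_le m h σ

theorem contP_mono (A : Set (APlay K ar)) (σ τ : PlayMeasure K ar)
    (h : ∀ s k, τ.pass s k ≤ σ.pass s k) (m : ℕ) : contP A τ m ≤ contP A σ m := by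
  refine ENNReal.tsum_le_tsum fun s => ?_
  split_ifs
  · exact ENNReal.tsum_le_tsum fun k => h s k
  · exact le_rfl

theorem prefixPlay_succ (f : ℕ → Σ k : K, ar k) (n : ℕ) :
    prefixPlay f (n + 1) = .cons (f 0).1 (f 0).2 (prefixPlay (fun n => f (n + 1)) n) := by
  induction n with
  | zero => rfl
  | succ n ih =>
    rw [prefixPlay, ih]; rfl

theorem not_wf (P : PlayMeasure K ar → Prop)
    (h : ∀ σ, P σ → ∃ x : Σ k : K, ar k, 0 < σ.pass .nil x.1 ∧ P (shift σ x.1 x.2))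
    (σ : PlayMeasure K ar) (hσ : P σ) : ¬ σ.WellFoundedPM := by
  intro hw
  apply hw
  clear hw
  have hK : Nonempty (Σ k : K, ar k) := ⟨(h σ hσ).choose⟩
  choose! c hc hP using h
  let next : PlayMeasure K ar → PlayMeasure K ar := fun σ => shift σ (c σ).1 (c σ).2
  let F : PlayMeasure K ar → ℕ → Σ k : K, ar k := fun σ n => c (next^[n] σ)
  refine ⟨F σ, ?_⟩
  intro n
  induction n generalizing σ with
  | zero => exact hc σ hσ
  | succ n ih =>
    rw [prefixPlay_succ]
    exact ih (next σ) (hP σ hσ)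

theorem ff_contP {A : Set (APlay K ar)} (h : Good A) (σ : PlayMeasure K ar) (hσ : σ.FinFounded) :
    ∃ m, contP A σ m = 0 := by
  by_contra hcon
  push Not at hcon
  refine not_wf (fun σ => σ.FinBranch ∧ ∃ A, Good A ∧ ∀ m, contP A σ m ≠ 0) ?_ σ
    ⟨hσ.2, A, h, hcon⟩ hσ.1
  clear hcon h hσ A σ
  rintro σ ⟨hb, A, h, hA⟩
  by_contra hcon
  push Not at hcon
  have key : ∀ k, ∃ m, 0 < σ.pass .nil k → ∀ i, contP (shiftSet A k i) (shift σ k i) m = 0 := by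
    intro k
    by_cases hk : 0 < σ.pass .nil k
    · by_cases he : ∃ i : ar k, APlay.nil ∈ shiftSet A k i
      · obtain ⟨i, hi⟩ := he
        obtain ⟨m, hm⟩ := hcon ⟨k, i⟩ hk (fun t => hb (.cons k i t)) (shiftSet A k i) (h.shift k i)
        refine ⟨m, fun _ j => ?_⟩
        by_cases hj : APlay.nil ∈ shiftSet A k j
        · obtain rfl := h.unique hi hj
          exact hm
        · exact contP_of_nil (h.shift k j) hj _ _
      · push Not at he
        exact ⟨0, fun _ i => contP_of_nil (h.shift k i) (he i) _ _⟩
    · exact ⟨0, fun h => absurd h hk⟩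
  choose M hM using key
  let N := (hb .nil).toFinset.sup M
  apply hA (N + 1)
  rw [contP_succ]
  refine ENNReal.tsum_eq_zero.2 fun k => ENNReal.tsum_eq_zero.2 fun i => ?_
  by_cases hk : 0 < σ.pass .nil k
  · have hle : M k ≤ N := Finset.le_sup (f := M) ((hb .nil).mem_toFinset.2 hk)
    exact le_antisymm ((contP_antitone (h.shift k i) _ hle).trans (hM k hk i).le) zero_le
  · refine le_antisymm ((contP_le_weight _ (h.shift k i) _).trans ?_) zero_le
    rw [shift_weight]; exact not_lt.1 hk

theorem contP_tsum (A : Set (APlay K ar)) (σ : PlayMeasure K ar) (τ : ℕ → PlayMeasure K ar)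
    (h : ∀ s k, σ.pass s k = ∑' n, (τ n).pass s k) (m : ℕ) :
    contP A σ m = ∑' n, contP A (τ n) m := by
  unfold contP
  rw [ENNReal.tsum_comm]
  refine tsum_congr fun s => ?_
  split_ifs
  · unfold PlayMeasure.act
    rw [ENNReal.tsum_comm]
    exact tsum_congr fun k => h s k
  · simp

theorem backward (σ : PlayMeasure K ar) (τ : ℕ → PlayMeasure K ar)
    (hf : ∀ n, (τ n).FinFounded)
    (h : ∀ s k, σ.pass s k = ∑' n, (τ n).pass s k) : Victorious σ := by
  intro ρ
  have hg : Good ρ.act := ⟨ρ.prefix_closed, ρ.deterministic⟩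
  have e : ∀ m, contProb ρ σ m = ∫⁻ n, contP ρ.act (τ n) m ∂MeasureTheory.Measure.count := by
    intro m
    rw [contProb_eq, contP_tsum _ σ τ h, MeasureTheory.lintegral_count]
  simp_rw [e]
  rw [← MeasureTheory.lintegral_iInf]
  · have : ∀ n, ⨅ m, contP ρ.act (τ n) m = 0 := by
      intro n
      obtain ⟨m, hm⟩ := ff_contP hg (τ n) (hf n)
      exact le_antisymm ((iInf_le _ m).trans hm.le) zero_le
    simp [this]
  · intro m; exact measurable_from_top
  · intro a b hab n; exact contP_antitone hg (τ n) hab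
  · rw [← e, contProb_eq]
    exact ((contP_le_weight 0 hg σ).trans_lt
      ((weight_le_one σ).trans_lt ENNReal.one_lt_top)).ne

/-- Scaling a play-measure. -/
noncomputable def scale (c : ℝ≥0∞) (hc : c ≤ 1) (σ : PlayMeasure K ar) : PlayMeasure K ar where
  pass s k := c * σ.pass s k
  le_one t := by
    rw [ENNReal.tsum_mul_left]
    exact mul_le_one' hc (σ.le_one t)
  consistent s k i := by
    rw [ENNReal.tsum_mul_left, σ.consistent s k i]

theorem exists_scale (τ : PlayMeasure K ar) (hτ : τ.FinFounded) (y : ℝ≥0∞) (hy : y ≤ τ.weight) :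
    ∃ τ' : PlayMeasure K ar, τ'.FinFounded ∧ (∀ s k, τ'.pass s k ≤ τ.pass s k) ∧ τ'.weight = y := by
  have hc : y / τ.weight ≤ 1 := ENNReal.div_le_of_le_mul (by simpa using hy)
  have hle : ∀ s k, (scale _ hc τ).pass s k ≤ τ.pass s k := fun s k =>
    mul_le_of_le_one_left' hc
  refine ⟨scale _ hc τ, ⟨?_, ?_⟩, hle, ?_⟩
  · rintro ⟨f, hf⟩
    exact hτ.1 ⟨f, fun n => (hf n).trans_le (hle _ _)⟩
  · intro t
    exact (hτ.2 t).subset fun k hk => lt_of_lt_of_le hk (hle _ _)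
  · have : (scale _ hc τ).weight = y / τ.weight * τ.weight := ENNReal.tsum_mul_left
    rw [this]
    by_cases h0 : τ.weight = 0
    · rw [h0] at hy ⊢; simp at hy; simp [hy]
    · exact ENNReal.div_mul_cancel h0 ((weight_le_one τ).trans_lt ENNReal.one_lt_top).ne

/-- Supremum of weights of finitely founded play-measures below `σ`. -/
noncomputable def V (σ : PlayMeasure K ar) : ℝ≥0∞ :=
  ⨆ τ : {τ : PlayMeasure K ar // τ.FinFounded ∧ ∀ s k, τ.pass s k ≤ σ.pass s k}, τ.1.weight

noncomputable def defect (σ : PlayMeasure K ar) : ℝ≥0∞ := σ.weight - V σ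

theorem exists_of_lt_V (σ : PlayMeasure K ar) (y : ℝ≥0∞) (hy : y < V σ) :
    ∃ τ : PlayMeasure K ar, τ.FinFounded ∧ (∀ s k, τ.pass s k ≤ σ.pass s k) ∧ τ.weight = y := by
  obtain ⟨⟨τ, h1, h2⟩, h3⟩ := lt_iSup_iff.1 hy
  obtain ⟨τ', a, b, c⟩ := exists_scale τ h1 y h3.le
  exact ⟨τ', a, fun s k => (b s k).trans (h2 s k), c⟩

theorem exists_zero (σ : PlayMeasure K ar) :
    ∃ τ : PlayMeasure K ar, τ.FinFounded ∧ (∀ s k, τ.pass s k ≤ σ.pass s k) ∧ τ.weight = 0 :=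
  ⟨⟨fun _ _ => 0, by simp, by simp⟩, ⟨by rintro ⟨f, hf⟩; simpa using hf 0, fun t => by simp⟩,
    by simp, by simp [PlayMeasure.weight, PlayMeasure.act]⟩

def gluePass (y : K → ℝ≥0∞) (T : (k : K) → ar k → PlayMeasure K ar) : APlay K ar → K → ℝ≥0∞
  | .nil, k => y k
  | .cons k i s, l => (T k i).pass s l

noncomputable def glue (y : K → ℝ≥0∞) (hy : ∑' k, y k ≤ 1)
    (T : (k : K) → ar k → PlayMeasure K ar) (hT : ∀ k i, (T k i).weight = y k) :
    PlayMeasure K ar where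
  pass := gluePass y T
  le_one t := by
    cases t with
    | nil => exact hy
    | cons k i s => exact (T k i).le_one s
  consistent s k i := by
    cases s with
    | nil => exact (hT k i).symm
    | cons l j s => exact (T l j).consistent s k i

theorem V_ge (σ : PlayMeasure K ar) (F : Finset K) (y : K → ℝ≥0∞)
    (hF : ∀ k, k ∉ F → y k = 0) (hy : ∀ k, y k ≤ σ.pass .nil k)
    (h : ∀ k i, y k ≠ 0 → y k < V (shift σ k i)) : ∑' k, y k ≤ V σ := by
  have hex : ∀ k (i : ar k), ∃ τ : PlayMeasure K ar, τ.FinFounded ∧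
      (∀ s l, τ.pass s l ≤ (shift σ k i).pass s l) ∧ τ.weight = y k := by
    intro k i
    by_cases h0 : y k = 0
    · rw [h0]; exact exists_zero _
    · exact exists_of_lt_V _ _ (h k i h0)
  choose T hT1 hT2 hT3 using hex
  have hy1 : ∑' k, y k ≤ 1 := (ENNReal.tsum_le_tsum hy).trans (σ.le_one _)
  refine le_iSup_of_le ⟨glue y hy1 T hT3, ⟨?_, ?_⟩, ?_⟩ ?_
  · rintro ⟨f, hf⟩
    refine (hT1 (f 0).1 (f 0).2).1 ⟨fun n => f (n + 1), fun n => ?_⟩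
    have := hf (n + 1)
    rw [prefixPlay_succ] at this
    exact this
  · intro t
    cases t with
    | nil =>
      refine F.finite_toSet.subset fun k hk => ?_
      by_contra hkF
      have hk' : 0 < y k := hk
      exact hk'.ne' (hF k hkF)
    | cons k i s => exact (hT1 k i).2 s
  · intro s k
    cases s with
    | nil => exact hy k
    | cons l j s => exact hT2 l j s k
  · exact le_rfl

noncomputable def D (σ : PlayMeasure K ar) (k : K) : ℝ≥0∞ := ⨆ i : ar k, defect (shift σ k i)

theorem tsum_le_V (σ : PlayMeasure K ar) : ∑' k, (σ.pass .nil k - D σ k) ≤ V σ := by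
  rw [ENNReal.tsum_eq_iSup_sum]
  refine iSup_le fun F => ?_
  refine ENNReal.le_of_forall_lt_one_mul_le fun r hr => ?_
  let z : K → ℝ≥0∞ := fun k => σ.pass .nil k - D σ k
  let y : K → ℝ≥0∞ := fun k => if k ∈ F then r * z k else 0
  have hzp : ∀ k, z k ≤ σ.pass .nil k := fun k => tsub_le_self
  have hle : ∀ k, y k ≤ z k := by
    intro k
    by_cases hk : k ∈ F
    · simp only [y, if_pos hk]; exact mul_le_of_le_one_left' hr.le
    · simp [y, if_neg hk]
  have e : ∑' k, y k = r * ∑ k ∈ F, z k := by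
    rw [tsum_eq_sum (s := F) (fun k hk => by simp [y, hk]), Finset.mul_sum]
    exact Finset.sum_congr rfl fun k hk => by simp [y, hk]
  change r * ∑ k ∈ F, z k ≤ V σ
  rw [← e]
  refine V_ge σ F y (fun k hk => by simp [y, hk]) (fun k => (hle k).trans (hzp k)) ?_
  intro k i hk0
  have hkF : k ∈ F := by by_contra hk; simp [y, hk] at hk0
  have hz0 : z k ≠ 0 := fun h0 => hk0 (le_antisymm ((hle k).trans h0.le) zero_le)
  have hp1 : σ.pass .nil k < ∞ :=
    ((pass_nil_le σ k).trans (weight_le_one σ)).trans_lt ENNReal.one_lt_top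
  have hz1 : z k ≠ ∞ := ((hzp k).trans_lt hp1).ne
  have hlt : y k < z k := by
    simp only [y, if_pos hkF]
    simpa using ENNReal.mul_lt_mul_left hz0 hz1 hr
  refine hlt.trans_le ?_
  have h1 : defect (shift σ k i) ≤ D σ k := le_iSup (fun i => defect (shift σ k i)) i
  refine (tsub_le_tsub_left h1 _).trans ?_
  rw [defect, shift_weight]
  exact tsub_tsub_le

theorem defect_le (σ : PlayMeasure K ar) : defect σ ≤ ∑' k, D σ k := by
  rw [defect, tsub_le_iff_right]
  calc σ.weight ≤ ∑' k, (D σ k + (σ.pass .nil k - D σ k)) :=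
        ENNReal.tsum_le_tsum fun k => le_add_tsub
    _ = ∑' k, D σ k + ∑' k, (σ.pass .nil k - D σ k) := ENNReal.tsum_add
    _ ≤ _ := by gcongr; exact tsum_le_V σ

/-- An increasing sequence in `(0,1)`. -/
noncomputable def a (n : ℕ) : ℝ≥0∞ := 1 - (2 : ℝ≥0∞)⁻¹ ^ (n + 1)

theorem a_le (n : ℕ) : a n ≤ 1 := tsub_le_self

theorem a_pos (n : ℕ) : 0 < a n :=
  tsub_pos_iff_lt.2 (pow_lt_one' (by simp) (by simp))

theorem a_lt (n : ℕ) : a n < a (n + 1) := by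
  have hne : (2 : ℝ≥0∞)⁻¹ ^ (n + 1) ≠ ∞ := ENNReal.pow_ne_top (by simp)
  have hpos : (2 : ℝ≥0∞)⁻¹ ^ (n + 1) ≠ 0 := pow_ne_zero _ (by simp)
  have hlt : (2 : ℝ≥0∞)⁻¹ ^ (n + 1 + 1) < (2 : ℝ≥0∞)⁻¹ ^ (n + 1) := by
    have hhalf : (2 : ℝ≥0∞)⁻¹ ^ (n + 2) + (2 : ℝ≥0∞)⁻¹ ^ (n + 2) = (2 : ℝ≥0∞)⁻¹ ^ (n + 1) := by
      rw [pow_succ _ (n + 1), ← mul_add, ENNReal.inv_two_add_inv_two, mul_one]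
    conv_rhs => rw [← hhalf]
    exact ENNReal.lt_add_right (ENNReal.pow_ne_top (by simp)) (pow_ne_zero _ (by simp))
  have h1 : (2 : ℝ≥0∞)⁻¹ ^ (n + 1) ≤ 1 := pow_le_one' (by simp) _
  exact (ENNReal.cancel_of_ne (tsub_le_self.trans_lt ENNReal.one_lt_top).ne).tsub_lt_tsub_left_of_le h1 hlt

theorem exists_choice (σ : PlayMeasure K ar) (n : ℕ) (k : K) (h : D σ k ≠ 0) :
    ∃ i : ar k, a n * D σ k ≤ a (n + 1) * defect (shift σ k i) := by
  have hD : D σ k ≠ ∞ := by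
    have : D σ k ≤ 1 := iSup_le fun i => tsub_le_self.trans (weight_le_one _)
    exact (this.trans_lt ENNReal.one_lt_top).ne
  have hlt : a n * D σ k < a (n + 1) * D σ k := by
    simpa using ENNReal.mul_lt_mul_left h hD (a_lt n)
  conv_rhs at hlt => rw [D, ENNReal.mul_iSup]
  obtain ⟨i, hi⟩ := lt_iSup_iff.1 hlt
  exact ⟨i, hi.le⟩

/-- The plays compatible with the near-optimal counterstrategy. -/
def memC (c : PlayMeasure K ar → ℕ → (k : K) → Option (ar k)) :
    PlayMeasure K ar → ℕ → APlay K ar → Prop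
  | _, _, .nil => True
  | σ, n, .cons k i s => c σ n k = some i ∧ memC c (shift σ k i) (n + 1) s

theorem memC_pc (c : PlayMeasure K ar → ℕ → (k : K) → Option (ar k)) (s : APlay K ar) :
    ∀ (σ : PlayMeasure K ar) (n : ℕ) (k : K) (i : ar k), memC c σ n (s.snoc k i) → memC c σ n s := by
  induction s with
  | nil => exact fun _ _ _ _ _ => trivial
  | cons l j s ih => exact fun σ n k i h => ⟨h.1, ih _ _ k i h.2⟩

theorem memC_det (c : PlayMeasure K ar → ℕ → (k : K) → Option (ar k)) (s : APlay K ar) :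
    ∀ (σ : PlayMeasure K ar) (n : ℕ) (k : K) (i j : ar k), memC c σ n (s.snoc k i) →
      memC c σ n (s.snoc k j) → i = j := by
  induction s with
  | nil => exact fun σ n k i j h h' => Option.some.inj (h.1.symm.trans h'.1)
  | cons l j s ih => exact fun σ n k i j h h' => ih _ _ k i j h.2 h'.2

theorem contP_memC (c : PlayMeasure K ar → ℕ → (k : K) → Option (ar k))
    (hc : ∀ σ n k, D σ k ≠ 0 → ∃ i, c σ n k = some i ∧
      a n * D σ k ≤ a (n + 1) * defect (shift σ k i)) (m : ℕ) :
    ∀ (σ : PlayMeasure K ar) (n : ℕ), a n * defect σ ≤ contP {s | memC c σ n s} σ m := by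
  induction m with
  | zero =>
    intro σ n
    rw [contP_zero, if_pos (by trivial)]
    exact (mul_le_of_le_one_left' (a_le n)).trans tsub_le_self
  | succ m ih =>
    intro σ n
    rw [contP_succ]
    refine (mul_le_mul_right (defect_le σ) (a n)).trans ?_
    rw [← ENNReal.tsum_mul_left]
    refine ENNReal.tsum_le_tsum fun k => ?_
    by_cases h0 : D σ k = 0
    · simp [h0]
    obtain ⟨i, hi, hle⟩ := hc σ n k h0
    refine hle.trans ((ih (shift σ k i) (n + 1)).trans ?_)
    refine le_trans (le_of_eq ?_) (ENNReal.le_tsum i)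
    congr 1
    ext s
    simp [shiftSet, memC, hi]

theorem defect_eq_zero (σ : PlayMeasure K ar) (hσ : Victorious σ) : defect σ = 0 := by
  have hex : ∀ (σ : PlayMeasure K ar) (n : ℕ) (k : K), ∃ o : Option (ar k), D σ k ≠ 0 →
      ∃ i, o = some i ∧ a n * D σ k ≤ a (n + 1) * defect (shift σ k i) := by
    intro σ n k
    by_cases h : D σ k = 0
    · exact ⟨none, fun h' => absurd h h'⟩
    · obtain ⟨i, hi⟩ := exists_choice σ n k h
      exact ⟨some i, fun _ => ⟨i, rfl, hi⟩⟩
  choose c hc using hex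
  let ρ : Counterstrategy K ar :=
    ⟨{s | memC c σ 0 s}, trivial, fun s => memC_pc c s σ 0, fun s => memC_det c s σ 0⟩
  have h := hσ ρ
  have h2 : a 0 * defect σ ≤ ⨅ m, contProb ρ σ m := by
    refine le_iInf fun m => ?_
    rw [contProb_eq]
    exact contP_memC c hc m σ 0
  rw [h] at h2
  rcases mul_eq_zero.1 (le_antisymm h2 zero_le) with h3 | h3
  · exact absurd h3 (a_pos 0).ne'
  · exact h3

theorem tsum_diff (f g : K → ℝ≥0∞) (hg : ∑' k, g k ≤ 1) (h : ∀ k, g k ≤ f k) :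
    ∑' k, (f k - g k) = ∑' k, f k - ∑' k, g k := by
  refine ENNReal.eq_sub_of_add_eq (hg.trans_lt ENNReal.one_lt_top).ne ?_
  rw [← ENNReal.tsum_add]
  exact tsum_congr fun k => tsub_add_cancel_of_le (h k)

/-- Difference of play-measures. -/
noncomputable def diff (σ τ : PlayMeasure K ar) (h : ∀ s k, τ.pass s k ≤ σ.pass s k) :
    PlayMeasure K ar where
  pass s k := σ.pass s k - τ.pass s k
  le_one t := (ENNReal.tsum_le_tsum fun k => tsub_le_self).trans (σ.le_one t)
  consistent s k i := by
    rw [tsum_diff _ _ (τ.le_one _) (fun l => h _ l),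
      ← σ.consistent, ← τ.consistent]

theorem step (σ : PlayMeasure K ar) (n : ℕ) (hv : Victorious σ)
    (hw : σ.weight = (2 : ℝ≥0∞)⁻¹ ^ n) :
    ∃ τ σ' : PlayMeasure K ar, τ.FinFounded ∧ τ.weight = (2 : ℝ≥0∞)⁻¹ ^ (n + 1) ∧
      (∀ s k, σ.pass s k = τ.pass s k + σ'.pass s k) ∧
      Victorious σ' ∧ σ'.weight = (2 : ℝ≥0∞)⁻¹ ^ (n + 1) := by
  have hV : (2 : ℝ≥0∞)⁻¹ ^ n ≤ V σ := by
    rw [← hw]; exact tsub_eq_zero_iff_le.1 (defect_eq_zero σ hv)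
  have hhalf : (2 : ℝ≥0∞)⁻¹ ^ (n + 1) + (2 : ℝ≥0∞)⁻¹ ^ (n + 1) = (2 : ℝ≥0∞)⁻¹ ^ n := by
    rw [pow_succ, ← mul_add, ENNReal.inv_two_add_inv_two, mul_one]
  have hne : (2 : ℝ≥0∞)⁻¹ ^ (n + 1) ≠ ∞ := ENNReal.pow_ne_top (by simp)
  have hpos : (2 : ℝ≥0∞)⁻¹ ^ (n + 1) ≠ 0 := pow_ne_zero _ (by simp)
  have hlt : (2 : ℝ≥0∞)⁻¹ ^ (n + 1) < (2 : ℝ≥0∞)⁻¹ ^ n := by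
    conv_rhs => rw [← hhalf]
    exact ENNReal.lt_add_right hne hpos
  obtain ⟨τ, h1, h2, h3⟩ := exists_of_lt_V σ _ (hlt.trans_le hV)
  refine ⟨τ, diff σ τ h2, h1, h3, fun s k => (add_tsub_cancel_of_le (h2 s k)).symm, ?_, ?_⟩
  · intro ρ
    refine le_antisymm ?_ zero_le
    rw [← hv ρ]
    refine iInf_mono fun m => ?_
    rw [contProb_eq, contProb_eq]
    exact contP_mono _ _ _ (fun s k => tsub_le_self) m
  · have : (diff σ τ h2).weight = σ.weight - τ.weight :=
      tsum_diff _ _ (τ.le_one _) (fun l => h2 _ l)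
    rw [this, h3, hw, ← hhalf, ENNReal.add_sub_cancel_right hne]

theorem forward (σ : PlayMeasure K ar) (hσ : σ.weight = 1) (hv : Victorious σ) :
    ∃ τ : ℕ → PlayMeasure K ar,
        (∀ n, (τ n).FinFounded) ∧
        (∀ n, (τ n).weight = (2 : ℝ≥0∞)⁻¹ ^ (n + 1)) ∧
        (∀ s k, σ.pass s k = ∑' n, (τ n).pass s k) := by
  choose T S h1 h2 h3 h4 h5 using @step K ar
  let R : (n : ℕ) → {σ : PlayMeasure K ar // Victorious σ ∧ σ.weight = (2 : ℝ≥0∞)⁻¹ ^ n} :=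
    fun n => Nat.rec ⟨σ, hv, by simpa using hσ⟩
      (fun n x => ⟨S x.1 n x.2.1 x.2.2, h4 x.1 n x.2.1 x.2.2, h5 x.1 n x.2.1 x.2.2⟩) n
  let τ : ℕ → PlayMeasure K ar := fun n => T (R n).1 n (R n).2.1 (R n).2.2
  refine ⟨τ, fun n => h1 _ _ _ _, fun n => h2 _ _ _ _, fun s k => ?_⟩
  have hsum : ∀ N, σ.pass s k = ∑ n ∈ Finset.range N, (τ n).pass s k + (R N).1.pass s k := by
    intro N
    induction N with
    | zero => simp [R]
    | succ N ih =>
      rw [ih, Finset.sum_range_succ, add_assoc]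
      congr 1
      exact h3 (R N).1 N (R N).2.1 (R N).2.2 s k
  have hR : Filter.Tendsto (fun N => (R N).1.pass s k) Filter.atTop (nhds 0) := by
    refine tendsto_of_tendsto_of_tendsto_of_le_of_le tendsto_const_nhds
      (ENNReal.tendsto_pow_atTop_nhds_zero_of_lt_one (r := (2 : ℝ≥0∞)⁻¹) (by simp))
      (fun N => zero_le) (fun N => ?_)
    exact (pass_le_weight s _ k).trans (R N).2.2.le
  have hT := (ENNReal.tendsto_nat_tsum fun n => (τ n).pass s k).add hR
  rw [add_zero] at hT
  refine tendsto_nhds_unique (Filter.Tendsto.congr (fun N => hsum N) tendsto_const_nhds) hT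

end PMAux

/-- A probabilistic trace strategy is victorious iff it is the countable sum
of finitely founded play-measures `τ_k` of weight `2^{-k-1}`. -/
theorem stmt_13 {K : Type} {ar : K → Type} (σ : PlayMeasure K ar)
    (hσ : σ.weight = 1) :
    Victorious σ ↔
      ∃ τ : ℕ → PlayMeasure K ar,
        (∀ n, (τ n).FinFounded) ∧
        (∀ n, (τ n).weight = (2 : ℝ≥0∞)⁻¹ ^ (n + 1)) ∧
        (∀ s k, σ.pass s k = ∑' n, (τ n).pass s k) := by
  constructor
  · exact PMAux.forward σ hσ
  · rintro ⟨τ, h1, -, h3⟩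
    exact PMAux.backward σ τ h1 h3
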